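/- Let u^± be the solutions of the BBM initial-value problem with data φ^±, η the solution of the BBM-KP initial-value problem with data ψ, and define w(x,y,t) = η − ½(u^+ + u^−) − ½(u^+ − u^−) tanh y. Then w satisfies the equation w_t + w_x − w_{xxt} − ∂_x^{−1} η_{yy} + w w_x + ½(1 + tanh y)(u^+ w)_x + ½(1 − tanh y)(u^− w)_x − ¼(1 − tanh² y)(u^+ u^+_x + u^− u^−_x − u^+ u^−_x − u^− u^+_x) = 0, with initial data w(x,y,0) = ψ(x,y) − ½[φ^+ + φ^−] − ½[φ^+ − φ^−] tanh y. -/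

import Mathlib

/- Formalization of statements from "On the Solutions of the BBM-KP and BBM model
Equations" (Grey–Tom). All functions are real-valued; `u t x`, `η t y x`. -/

noncomputable section

open MeasureTheory Filter Topology
open scoped FourierTransform

/-- Squared Fourier-based `H^s(ℝ)` norm, `∫ (1+ξ²)^s |f̂(ξ)|² dξ`. -/
def hsNormSq (s : ℝ) (f : ℝ → ℝ) : ℝ :=
  ∫ ξ : ℝ, (1 + ξ ^ 2) ^ s * ‖𝓕 (fun x : ℝ => (f x : ℂ)) ξ‖ ^ 2

/-- Fourier-based `H^s(ℝ)` norm. -/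
def hsNorm (s : ℝ) (f : ℝ → ℝ) : ℝ := Real.sqrt (hsNormSq s f)

/-- Membership in `H^s(ℝ)`. -/
def MemHs (s : ℝ) (f : ℝ → ℝ) : Prop :=
  Integrable (fun ξ : ℝ => (1 + ξ ^ 2) ^ s * ‖𝓕 (fun x : ℝ => (f x : ℂ)) ξ‖ ^ 2)

/-- `u` satisfies the BBM equation `u_t + u_x + u u_x - u_xxt = 0` at `(t, x)`. -/
def SolvesBBMAt (u : ℝ → ℝ → ℝ) (t x : ℝ) : Prop :=
  deriv (fun τ => u τ x) t + deriv (u t) x + u t x * deriv (u t) x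
    - deriv (fun τ => deriv (deriv (u τ)) x) t = 0

/-- `t ↦ u t` is an `H^s(ℝ)`-valued continuous function on `I ⊆ ℝ`. -/
def ContHsOn (s : ℝ) (I : Set ℝ) (u : ℝ → ℝ → ℝ) : Prop :=
  (∀ t ∈ I, MemHs s (u t)) ∧
    ∀ t₀ ∈ I, Tendsto (fun t => hsNorm s (fun x => u t x - u t₀ x))
      (nhdsWithin t₀ I) (nhds 0)

/-- `u ∈ C(I; H^s(ℝ))` solves the BBM initial-value problem with data `φ` on `I`. -/
def IsBBMSolOn (s : ℝ) (φ : ℝ → ℝ) (I : Set ℝ) (u : ℝ → ℝ → ℝ) : Prop :=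
  (∀ t ∈ I, ∀ x, SolvesBBMAt u t x) ∧ (∀ x, u 0 x = φ x) ∧ ContHsOn s I u

/-- `w = η - ½(u⁺ + u⁻) - ½(u⁺ - u⁻) tanh y`. -/
def wOf (η : ℝ → ℝ → ℝ → ℝ) (up um : ℝ → ℝ → ℝ) : ℝ → ℝ → ℝ → ℝ :=
  fun t y x => η t y x - (up t x + um t x) / 2 - (up t x - um t x) / 2 * Real.tanh y

/-- The equation satisfied by `w` (with `Θ = ∂ₓ⁻¹ η_yy`):
`w_t + w_x - w_xxt - ∂ₓ⁻¹η_yy + w w_x + ½(1+tanh y)(u⁺w)_x + ½(1-tanh y)(u⁻w)_x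
  - ¼(1-tanh²y)(u⁺u⁺_x + u⁻u⁻_x - u⁺u⁻_x - u⁻u⁺_x) = 0`. -/
def WEquationAt (up um : ℝ → ℝ → ℝ) (Θ w : ℝ → ℝ → ℝ → ℝ) (t y x : ℝ) : Prop :=
  deriv (fun τ => w τ y x) t + deriv (w t y) x
    - deriv (fun τ => deriv (deriv (w τ y)) x) t
    - Θ t y x + w t y x * deriv (w t y) x
    + 1 / 2 * (1 + Real.tanh y) * deriv (fun a => up t a * w t y a) x
    + 1 / 2 * (1 - Real.tanh y) * deriv (fun a => um t a * w t y a) x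
    - 1 / 4 * (1 - Real.tanh y ^ 2) *
        (up t x * deriv (up t) x + um t x * deriv (um t) x
          - up t x * deriv (um t) x - um t x * deriv (up t) x) = 0

/-- `η_yy(t, y, ·)` as a function of `x`. -/
def etaYY (η : ℝ → ℝ → ℝ → ℝ) (t y : ℝ) : ℝ → ℝ :=
  fun x => deriv (fun b => deriv (fun c => η t c x) b) y

/-- `Θ = ∂ₓ⁻¹ η_yy`: `Θ` is an `x`-antiderivative of `η_yy`. -/
def IsXAntiderivOfEtaYY (η Θ : ℝ → ℝ → ℝ → ℝ) : Prop :=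
  ∀ t y x, deriv (Θ t y) x = etaYY η t y x

/-- Joint smoothness of a function of two real variables. -/
def Smooth2 (u : ℝ → ℝ → ℝ) : Prop :=
  ContDiff ℝ (⊤ : ℕ∞) fun p : ℝ × ℝ => u p.1 p.2

/-- Joint smoothness of a function of three real variables. -/
def Smooth3 (η : ℝ → ℝ → ℝ → ℝ) : Prop :=
  ContDiff ℝ (⊤ : ℕ∞) fun p : ℝ × ℝ × ℝ => η p.1 p.2.1 p.2.2

theorem Smooth2.deriv_snd {u : ℝ → ℝ → ℝ} (h : Smooth2 u) :
    Smooth2 fun t x => deriv (u t) x := by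
  have key : ContDiff ℝ (⊤ : ℕ∞) fun p : ℝ × ℝ => fderiv ℝ (u p.1) p.2 1 := by
    refine ContDiff.fderiv_apply (m := (⊤ : ℕ∞)) (n := (⊤ : ℕ∞)) (f := fun p : ℝ × ℝ => u p.1) ?_
      contDiff_snd contDiff_const (by simp)
    exact ContDiff.comp h (contDiff_fst.fst.prodMk contDiff_snd)
  exact key

theorem Smooth2.differentiable_fst {u : ℝ → ℝ → ℝ} (h : Smooth2 u) (x : ℝ) :
    Differentiable ℝ fun t => u t x :=
  (ContDiff.comp h (contDiff_id.prodMk contDiff_const)).differentiable (by simp)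

theorem Smooth2.differentiable_snd {u : ℝ → ℝ → ℝ} (h : Smooth2 u) (t : ℝ) :
    Differentiable ℝ (u t) :=
  (ContDiff.comp h (contDiff_const.prodMk contDiff_id)).differentiable (by simp)

theorem Smooth3.smooth2 {η : ℝ → ℝ → ℝ → ℝ} (h : Smooth3 η) (y : ℝ) :
    Smooth2 fun t x => η t y x :=
  ContDiff.comp h (contDiff_fst.prodMk (contDiff_const.prodMk contDiff_snd))

theorem deriv_sub_combination {f g h : ℝ → ℝ} (hf : Differentiable ℝ f)
    (hg : Differentiable ℝ g) (hh : Differentiable ℝ h) (T x : ℝ) :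
    deriv (fun a => f a - (g a + h a) / 2 - (g a - h a) / 2 * T) x =
      deriv f x - (deriv g x + deriv h x) / 2 - (deriv g x - deriv h x) / 2 * T :=
  (((hf x).hasDerivAt.sub (((hg x).hasDerivAt.add (hh x).hasDerivAt).div_const 2)).sub
    ((((hg x).hasDerivAt.sub (hh x).hasDerivAt).div_const 2).mul_const T)).deriv

/-- Let `u±` solve the BBM equation, and let `η` solve the BBM-KP
equation (in the `x`-integrated form `η_t + η_x + η η_x - η_xxt = ∂ₓ⁻¹η_yy = Θ`, which
is equation (1.2) integrated once in `x`). Set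
`w = η - ½(u⁺ + u⁻) - ½(u⁺ - u⁻) tanh y`. Then `w` satisfies
`w_t + w_x - w_xxt - ∂ₓ⁻¹η_yy + w w_x + ½(1+tanh y)(u⁺w)_x + ½(1-tanh y)(u⁻w)_x
 - ¼(1-tanh²y)(u⁺u⁺_x + u⁻u⁻_x - u⁺u⁻_x - u⁻u⁺_x) = 0`,
with initial data `w(x,y,0) = ψ(x,y) - ½[φ⁺+φ⁻] - ½[φ⁺-φ⁻] tanh y`. -/
theorem w_satisfies_equation
    (up um : ℝ → ℝ → ℝ) (η Θ : ℝ → ℝ → ℝ → ℝ) (ψ : ℝ → ℝ → ℝ) (φp φm : ℝ → ℝ)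
    (hsup : Smooth2 up) (hsum : Smooth2 um) (hsη : Smooth3 η) (hsΘ : Smooth3 Θ)
    (hBBMp : ∀ t x, SolvesBBMAt up t x) (hBBMm : ∀ t x, SolvesBBMAt um t x)
    (hΘ : IsXAntiderivOfEtaYY η Θ)
    (hKP : ∀ t y x,
      deriv (fun τ => η τ y x) t + deriv (η t y) x + η t y x * deriv (η t y) x
        - deriv (fun τ => deriv (deriv (η τ y)) x) t = Θ t y x)
    (hup0 : ∀ x, up 0 x = φp x) (hum0 : ∀ x, um 0 x = φm x)
    (hη0 : ∀ y x, η 0 y x = ψ x y) :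
    (∀ t y x, WEquationAt up um Θ (wOf η up um) t y x) ∧
      ∀ y x, wOf η up um 0 y x =
        ψ x y - (φp x + φm x) / 2 - (φp x - φm x) / 2 * Real.tanh y := by
  refine ⟨fun t y x => ?_, fun y x => by simp only [wOf, hup0, hum0, hη0]⟩
  have hη := hsη.smooth2 y
  have hwt : deriv (fun τ => wOf η up um τ y x) t = _ :=
    deriv_sub_combination (hη.differentiable_fst x) (hsup.differentiable_fst x)
      (hsum.differentiable_fst x) (Real.tanh y) t
  have hwx : ∀ τ a, deriv (wOf η up um τ y) a = _ := fun τ a =>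
    deriv_sub_combination (hη.differentiable_snd τ) (hsup.differentiable_snd τ)
      (hsum.differentiable_snd τ) (Real.tanh y) a
  have hwxx : ∀ τ, deriv (deriv (wOf η up um τ y)) x = _ := fun τ =>
    (congrArg (fun f => deriv f x) (funext (hwx τ))).trans
      (deriv_sub_combination (hη.deriv_snd.differentiable_snd τ)
        (hsup.deriv_snd.differentiable_snd τ) (hsum.deriv_snd.differentiable_snd τ)
        (Real.tanh y) x)
  have hwxxt : deriv (fun τ => deriv (deriv (wOf η up um τ y)) x) t = _ :=
    (congrArg (fun f => deriv f t) (funext hwxx)).trans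
      (deriv_sub_combination (hη.deriv_snd.deriv_snd.differentiable_fst x)
        (hsup.deriv_snd.deriv_snd.differentiable_fst x)
        (hsum.deriv_snd.deriv_snd.differentiable_fst x) (Real.tanh y) t)
  have hw : DifferentiableAt ℝ (wOf η up um t y) x :=
    (((hη.differentiable_snd t).sub (((hsup.differentiable_snd t).add
      (hsum.differentiable_snd t)).div_const 2)).sub ((((hsup.differentiable_snd t).sub
      (hsum.differentiable_snd t)).div_const 2).mul_const (Real.tanh y))) x
  have hp := ((hsup.differentiable_snd t x).hasDerivAt.mul hw.hasDerivAt).deriv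
  have hm := ((hsum.differentiable_snd t x).hasDerivAt.mul hw.hasDerivAt).deriv
  have hup := hBBMp t x
  have hum := hBBMm t x
  have hkp := hKP t y x
  unfold SolvesBBMAt at hup hum
  unfold WEquationAt
  change deriv (fun a => up t a * wOf η up um t y a) x = _ at hp
  change deriv (fun a => um t a * wOf η up um t y a) x = _ at hm
  rw [hp, hm, hwt, hwxxt, hwx]
  simp only [wOf]
  linear_combination hkp - (1 + Real.tanh y) / 2 * hup - (1 - Real.tanh y) / 2 * hum
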